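/- Let c : ℤ/pℤ → ℚ be any function with c(0) = 0. Then for all indices m, l ∈ {0,…,p−2}, the (m,l) entry of the matrix Σ_{j=1}^{p−1} c(j)·Y^j equals c(r^l − r^m) − c(−r^m), where r^l − r^m and −r^m are computed in ℤ/pℤ. -/

import Mathlib

theorem aux_sum (p : ℕ) (hp : p.Prime) (r : ℕ) (hr : orderOf (r : ZMod p) = p - 1)
    (g : ZMod p → ℚ) [Fintype (ZMod p)] :
    ∑ k : Fin (p - 1), g ((r : ZMod p) ^ (k : ℕ)) = ∑ x, g x - g 0 := by
  haveI : Fact p.Prime := ⟨hp⟩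
  have h2 := hp.two_le
  have hr0 : (r : ZMod p) ≠ 0 := by
    intro h
    have : (r : ZMod p) ^ (p - 1) = 1 := by rw [← hr]; exact pow_orderOf_eq_one _
    rw [h, zero_pow (by omega)] at this
    exact zero_ne_one this
  have hinj : Function.Injective (fun k : Fin (p - 1) => (r : ZMod p) ^ (k : ℕ)) := by
    intro a b h
    apply Fin.ext
    exact pow_injOn_Iio_orderOf (by simp [hr]) (by simp [hr]) h
  have himg : Finset.univ.image (fun k : Fin (p - 1) => (r : ZMod p) ^ (k : ℕ))
      = Finset.univ.erase 0 := by
    apply Finset.eq_of_subset_of_card_le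
    · intro x hx
      simp only [Finset.mem_image, Finset.mem_univ, true_and] at hx
      obtain ⟨k, rfl⟩ := hx
      simp [hr0]
    · rw [Finset.card_image_of_injective _ hinj, Finset.card_erase_of_mem (Finset.mem_univ _)]
      simp [ZMod.card]
  have h1 := Finset.sum_image (s := Finset.univ) (f := g)
    (g := fun k : Fin (p - 1) => (r : ZMod p) ^ (k : ℕ)) (fun a _ b _ h => hinj h)
  rw [← h1, himg, ← Finset.sum_erase_add Finset.univ g (Finset.mem_univ 0)]
  ring

theorem aux_pow (p : ℕ) (hp : p.Prime)
    (r : ℕ) (hr : orderOf (r : ZMod p) = p - 1)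
    (Y : Matrix (Fin (p - 1)) (Fin (p - 1)) ℚ)
    (hY : ∀ i j, Y i j =
      if (r : ZMod p) ^ (i : ℕ) + 1 = 0 then -1
      else if (r : ZMod p) ^ (j : ℕ) = (r : ZMod p) ^ (i : ℕ) + 1 then 1 else 0)
    (n : ℕ) (m l : Fin (p - 1)) :
    (Y ^ n) m l = (if (r : ZMod p) ^ (l : ℕ) = (r : ZMod p) ^ (m : ℕ) + n then 1 else 0)
      - (if (r : ZMod p) ^ (m : ℕ) + n = 0 then 1 else 0) := by
  haveI : Fact p.Prime := ⟨hp⟩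
  have h2 := hp.two_le
  have hr0 : (r : ZMod p) ≠ 0 := by
    intro h
    have : (r : ZMod p) ^ (p - 1) = 1 := by rw [← hr]; exact pow_orderOf_eq_one _
    rw [h, zero_pow (by omega)] at this
    exact zero_ne_one this
  have hrp : ∀ k : ℕ, (r : ZMod p) ^ k ≠ 0 := fun k => pow_ne_zero _ hr0
  have hinj : Function.Injective (fun k : Fin (p - 1) => (r : ZMod p) ^ (k : ℕ)) := by
    intro a b h
    apply Fin.ext
    exact pow_injOn_Iio_orderOf (by simp [hr]) (by simp [hr]) h
  induction n generalizing m l with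
  | zero =>
    have : ((r : ZMod p) ^ (l : ℕ) = (r : ZMod p) ^ (m : ℕ)) ↔ m = l :=
      ⟨fun h => (hinj h).symm, fun h => by rw [h]⟩
    simp [Matrix.one_apply, this, hr0]
  | succ n ih =>
    rw [pow_succ, Matrix.mul_apply]
    have hY' : ∀ k, Y k l = (if (r : ZMod p) ^ (k : ℕ) = (r : ZMod p) ^ (l : ℕ) - 1 then 1 else 0)
        - (if (r : ZMod p) ^ (k : ℕ) = -1 then 1 else 0) := by
      intro k
      rw [hY]
      have := hrp l
      have e1 : ((r : ZMod p) ^ (k : ℕ) + 1 = 0) ↔ (r : ZMod p) ^ (k : ℕ) = -1 :=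
        eq_neg_iff_add_eq_zero.symm
      have e2 : ((r : ZMod p) ^ (l : ℕ) = (r : ZMod p) ^ (k : ℕ) + 1) ↔
        (r : ZMod p) ^ (k : ℕ) = (r : ZMod p) ^ (l : ℕ) - 1 := by
        rw [eq_sub_iff_add_eq, eq_comm]
      simp only [e1, e2]
      by_cases h : (r : ZMod p) ^ (k : ℕ) = -1
      · have : ¬ ((-1 : ZMod p) = (r : ZMod p) ^ (l : ℕ) - 1) := by
          intro h'
          apply hrp l
          linear_combination -h'
        simp [h, this]
      · simp [h]
    simp only [ih, hY']
    generalize (r : ZMod p) ^ (l : ℕ) = b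
    generalize hA : (r : ZMod p) ^ (m : ℕ) + (n : ZMod p) = a
    have hA' : (r : ZMod p) ^ (m : ℕ) + ((n + 1 : ℕ) : ZMod p) = a + 1 := by
      rw [← hA]; push_cast; ring
    rw [hA']
    rw [aux_sum p hp r hr (fun x => ((if x = a then (1 : ℚ) else 0) - (if a = 0 then 1 else 0)) *
      ((if x = b - 1 then 1 else 0) - (if x = -1 then 1 else 0)))]
    have e1 : (b = a + 1) ↔ a = b - 1 := by rw [eq_sub_iff_add_eq, eq_comm]
    have e2 : (a + 1 = 0) ↔ a = -1 := eq_neg_iff_add_eq_zero.symm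
    simp only [e1, e2, sub_mul, Finset.sum_sub_distrib, ← Finset.mul_sum, ite_mul, one_mul,
      zero_mul, Finset.sum_ite_eq', Finset.sum_ite_eq, Finset.mem_univ, if_true, eq_comm (a := (0 : ZMod p)) (b := a)]
    split_ifs <;> simp_all


/-- For any `c : ZMod p → ℚ` with `c 0 = 0`, the `(m,l)` entry of `∑_{j=1}^{p-1} c j • Y^j`
equals `c (r^l - r^m) - c (-r^m)`, computed in `ZMod p`. -/
theorem stmt_12 (p : ℕ) (hp : p.Prime)
    (r : ℕ) (hr : orderOf (r : ZMod p) = p - 1)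
    (Y : Matrix (Fin (p - 1)) (Fin (p - 1)) ℚ)
    (hY : ∀ i j, Y i j =
      if (r : ZMod p) ^ (i : ℕ) + 1 = 0 then -1
      else if (r : ZMod p) ^ (j : ℕ) = (r : ZMod p) ^ (i : ℕ) + 1 then 1 else 0)
    (c : ZMod p → ℚ) (hc : c 0 = 0) :
    ∀ m l : Fin (p - 1),
      (∑ j ∈ Finset.Icc 1 (p - 1), c (j : ZMod p) • Y ^ j) m l =
        c ((r : ZMod p) ^ (l : ℕ) - (r : ZMod p) ^ (m : ℕ)) -
          c (-(r : ZMod p) ^ (m : ℕ)) := by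
  haveI : Fact p.Prime := ⟨hp⟩
  have h2 := hp.two_le
  intro m l
  have key : ∀ g : ZMod p → ℚ, g 0 = 0 →
      ∑ j ∈ Finset.Icc 1 (p - 1), g (j : ZMod p) = ∑ x, g x := by
    intro g hg
    have h1 : ∑ j ∈ Finset.range p, g (j : ZMod p) = ∑ x, g x := by
      refine Finset.sum_bij' (fun j _ => (j : ZMod p)) (fun x _ => x.val) ?_ ?_ ?_ ?_ ?_
      · simp
      · intro x _; simpa using ZMod.val_lt x
      · intro j hj; exact ZMod.val_cast_of_lt (by simpa using hj)
      · intro x _; simp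
      · simp
    rw [← h1]
    apply Finset.sum_subset
    · intro x hx; simp at hx ⊢; omega
    · intro x hx hx'
      have : x = 0 := by simp at hx hx'; omega
      simp [this, hg]
  rw [Matrix.sum_apply]
  simp only [Matrix.smul_apply, aux_pow p hp r hr Y hY, smul_eq_mul]
  rw [key (fun x => c x * ((if (r : ZMod p) ^ (l : ℕ) = (r : ZMod p) ^ (m : ℕ) + x then 1 else 0)
      - (if (r : ZMod p) ^ (m : ℕ) + x = 0 then 1 else 0))) (by simp [hc])]
  have e1 : ∀ x, ((r : ZMod p) ^ (l : ℕ) = (r : ZMod p) ^ (m : ℕ) + x) ↔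
      x = (r : ZMod p) ^ (l : ℕ) - (r : ZMod p) ^ (m : ℕ) := fun x => by
    rw [eq_sub_iff_add_eq', eq_comm]
  have e2 : ∀ x, ((r : ZMod p) ^ (m : ℕ) + x = 0) ↔ x = -(r : ZMod p) ^ (m : ℕ) := fun x => by
    rw [eq_neg_iff_add_eq_zero, add_comm]
  simp [e1, e2, mul_sub, Finset.sum_sub_distrib]
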